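/- For the KKM potential V_I, the Poisson brackets C₁ = {A₁,B₁}, C₂ = {A₂,B₂}, L = {F,A₁}, M = {F,A₂} satisfy the linear dependence relation C₁ + C₂ + M + L = 0. -/

import Mathlib

noncomputable section

open MvPolynomial

/-- The field of rational functions over ℝ in the six variables
`x, y, z, p_x, p_y, p_z`: the fraction field of the polynomial ring. -/
abbrev K6 : Type := FractionRing (MvPolynomial (Fin 6) ℝ)

/-- The canonical embedding of the polynomial ring into its fraction field. -/
def toK6 : MvPolynomial (Fin 6) ℝ →+* K6 :=
  algebraMap (MvPolynomial (Fin 6) ℝ) K6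

/-- Constants, embedded in `K6`. -/
def cR (a : ℝ) : K6 := toK6 (MvPolynomial.C a)

def vx : K6 := toK6 (MvPolynomial.X 0)
def vy : K6 := toK6 (MvPolynomial.X 1)
def vz : K6 := toK6 (MvPolynomial.X 2)
def vpx : K6 := toK6 (MvPolynomial.X 3)
def vpy : K6 := toK6 (MvPolynomial.X 4)
def vpz : K6 := toK6 (MvPolynomial.X 5)

/-- `D` is the (unique) extension to the fraction field of the formal partial
derivative `pderiv j` on the polynomial ring: an additive map satisfying the
Leibniz rule which agrees with `pderiv j` on polynomials. -/
def IsPDeriv (j : Fin 6) (D : K6 → K6) : Prop :=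
  (∀ f g : K6, D (f + g) = D f + D g) ∧
  (∀ f g : K6, D (f * g) = D f * g + f * D g) ∧
  (∀ p, D (toK6 p) = toK6 (pderiv j p))

/-- The canonical Poisson bracket on `K6`, where `Pd 0, …, Pd 5` are the
partial derivatives with respect to `x, y, z, p_x, p_y, p_z` respectively:
`{f,g} = f_x g_{p_x} + f_y g_{p_y} + f_z g_{p_z}
  - f_{p_x} g_x - f_{p_y} g_y - f_{p_z} g_z`. -/
def poisson (Pd : Fin 6 → K6 → K6) (f g : K6) : K6 :=
  Pd 0 f * Pd 3 g + Pd 1 f * Pd 4 g + Pd 2 f * Pd 5 g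
    - Pd 3 f * Pd 0 g - Pd 4 f * Pd 1 g - Pd 5 f * Pd 2 g

/-- Angular momentum `J_x = y p_z - z p_y`. -/
def Jx : K6 := vy * vpz - vz * vpy
/-- Angular momentum `J_y = z p_x - x p_z`. -/
def Jy : K6 := vz * vpx - vx * vpz
/-- Angular momentum `J_z = x p_y - y p_x`. -/
def Jz : K6 := vx * vpy - vy * vpx
/-- Total angular momentum squared `J² = J_x² + J_y² + J_z²`. -/
def Jsq : K6 := Jx ^ 2 + Jy ^ 2 + Jz ^ 2

/-- KKM V_I Hamiltonian. -/
def HV (α₁ α₂ α₃ δ : ℝ) : K6 :=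
  vpx ^ 2 + vpy ^ 2 + vpz ^ 2 + cR δ * (vx ^ 2 + vy ^ 2 + vz ^ 2)
    + cR α₁ / vx ^ 2 + cR α₂ / vy ^ 2 + cR α₃ / vz ^ 2

def A1V (α₁ δ : ℝ) : K6 := vpx ^ 2 + cR δ * vx ^ 2 + cR α₁ / vx ^ 2

def A2V (α₃ δ : ℝ) : K6 := vpz ^ 2 + cR δ * vz ^ 2 + cR α₃ / vz ^ 2

def B1V (α₁ α₂ : ℝ) : K6 :=
  Jz ^ 2 + cR α₂ * vx ^ 2 / vy ^ 2 + cR α₁ * vy ^ 2 / vx ^ 2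

def B2V (α₂ α₃ : ℝ) : K6 :=
  Jx ^ 2 + cR α₃ * vy ^ 2 / vz ^ 2 + cR α₂ * vz ^ 2 / vy ^ 2

def FV (α₁ α₂ α₃ : ℝ) : K6 :=
  Jsq + cR α₂ * (vx ^ 2 + vz ^ 2) / vy ^ 2
    + (cR α₃ * vx ^ 2 * (vx ^ 2 + vy ^ 2) + cR α₁ * vz ^ 2 * (vy ^ 2 + vz ^ 2))
      / (vx ^ 2 * vz ^ 2)

namespace IsPDeriv

variable {j : Fin 6} {D : K6 → K6}

theorem map_sub (h : IsPDeriv j D) (f g : K6) : D (f - g) = D f - D g :=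
  _root_.map_sub (AddMonoidHom.mk' D h.1) f g

theorem map_sq (h : IsPDeriv j D) (f : K6) : D (f ^ 2) = 2 * f * D f := by
  rw [pow_two, h.2.1]
  ring

theorem map_div (h : IsPDeriv j D) (f g : K6) :
    D (f / g) = (g * D f - f * D g) / g ^ 2 := by
  rcases eq_or_ne g 0 with rfl | hg
  · simpa using h.2.2 0
  · have hf := h.2.1 (f / g) g
    rw [div_mul_cancel₀ f hg] at hf
    rw [hf]
    field_simp
    ring

theorem map_const (h : IsPDeriv j D) (a : ℝ) : D (cR a) = 0 := by
  rw [cR, h.2.2, pderiv_C, map_zero]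

theorem map_var (h : IsPDeriv j D) (i : Fin 6) :
    D (toK6 (X i)) = if i = j then 1 else 0 := by
  rw [h.2.2, pderiv_X, Pi.single_apply]
  split_ifs <;> simp

end IsPDeriv

theorem toK6_X_ne_zero (i : Fin 6) : toK6 (X i) ≠ 0 :=
  (map_ne_zero_iff toK6 (IsFractionRing.injective _ _)).2 (X_ne_zero i)

theorem kkm_VI_linear_relation (α₁ α₂ α₃ δ : ℝ) (Pd : Fin 6 → K6 → K6)
    (hPd : ∀ j, IsPDeriv j (Pd j))
    (H A1 A2 B1 B2 F : K6)
    (hH : H = HV α₁ α₂ α₃ δ) (hA1 : A1 = A1V α₁ δ) (hA2 : A2 = A2V α₃ δ)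
    (hB1 : B1 = B1V α₁ α₂) (hB2 : B2 = B2V α₂ α₃) (hF : F = FV α₁ α₂ α₃) :
    poisson Pd A1 B1 + poisson Pd A2 B2 + poisson Pd F A2 + poisson Pd F A1 = 0 := by
  subst hA1 hA2 hB1 hB2 hF
  have hx : vx ≠ 0 := toK6_X_ne_zero 0
  have hy : vy ≠ 0 := toK6_X_ne_zero 1
  have hz : vz ≠ 0 := toK6_X_ne_zero 2
  have hadd (j) := (hPd j).1
  have hmul (j) := (hPd j).2.1
  have hsub (j) := (hPd j).map_sub
  have hsq (j) := (hPd j).map_sq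
  have hdiv (j) := (hPd j).map_div
  have hconst (j) := (hPd j).map_const
  have hvx (j) : Pd j vx = if 0 = j then 1 else 0 := (hPd j).map_var 0
  have hvy (j) : Pd j vy = if 1 = j then 1 else 0 := (hPd j).map_var 1
  have hvz (j) : Pd j vz = if 2 = j then 1 else 0 := (hPd j).map_var 2
  have hvpx (j) : Pd j vpx = if 3 = j then 1 else 0 := (hPd j).map_var 3
  have hvpy (j) : Pd j vpy = if 4 = j then 1 else 0 := (hPd j).map_var 4
  have hvpz (j) : Pd j vpz = if 5 = j then 1 else 0 := (hPd j).map_var 5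
  simp only [poisson, A1V, A2V, B1V, B2V, FV, Jsq, Jx, Jy, Jz, hadd, hmul, hsub, hsq, hdiv,
    hconst, hvx, hvy, hvz, hvpx, hvpy, hvpz, Fin.reduceEq, if_true, if_false, mul_zero, zero_mul,
    add_zero, zero_add, sub_zero, zero_sub, mul_one, zero_div]
  field_simp
  ring
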